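/- Let ℓ ∈ ℕ and let K be the Legendre covariance kernel of degree ℓ. Then for every θ ∈ (0, π) and every φ ∈ ℝ, evaluating at the diagonal point θ₁ = θ₂ = θ, φ₁ = φ₂ = φ one has ∂⁴K/∂θ₁²∂θ₂² = 3 P_ℓ''(1) + P_ℓ'(1). -/

import Mathlib

open Real MeasureTheory

/-- The `l`-th Legendre polynomial, via Rodrigues' formula. -/
noncomputable def legendre (l : ℕ) : ℝ → ℝ :=
  fun t => (1 / (2 ^ l * (Nat.factorial l : ℝ))) * iteratedDeriv l (fun s => (s ^ 2 - 1) ^ l) t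

/-- The Legendre covariance kernel of degree `l`. -/
noncomputable def legendreKernel (l : ℕ) (θ₁ φ₁ θ₂ φ₂ : ℝ) : ℝ :=
  legendre l (Real.cos θ₁ * Real.cos θ₂ + Real.sin θ₁ * Real.sin θ₂ * Real.cos (φ₁ - φ₂))

theorem contDiff_legendre (l n : ℕ) : ContDiff ℝ n (legendre l) := by
  have h : ContDiff ℝ (n + l : ℕ) (fun s : ℝ => (s ^ 2 - 1) ^ l) := by fun_prop
  have h' := h.iterate_deriv' n l
  rw [← iteratedDeriv_eq_iterate] at h'
  exact contDiff_const.mul h'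

theorem iteratedDeriv_four_comp_cos_zero {f : ℝ → ℝ} (hf : ContDiff ℝ 4 f) :
    iteratedDeriv 4 (fun u => f (Real.cos u)) 0 = 3 * iteratedDeriv 2 f 1 + deriv f 1 := by
  have hd : ∀ k : ℕ, k < 4 → ∀ u, HasDerivAt (fun u => iteratedDeriv k f (Real.cos u))
      (iteratedDeriv (k + 1) f (Real.cos u) * -Real.sin u) u := fun k hk u => by
    rw [iteratedDeriv_succ]
    exact (hf.differentiable_iteratedDeriv k (by exact_mod_cast hk) _).hasDerivAt.comp u
      (Real.hasDerivAt_cos u)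
  have h1 : deriv (fun u => f (Real.cos u)) =
      fun u => iteratedDeriv 1 f (Real.cos u) * -Real.sin u :=
    funext fun u => by simpa using (hd 0 (by norm_num) u).deriv
  have h2 : deriv (fun u => iteratedDeriv 1 f (Real.cos u) * -Real.sin u) =
      fun u => Real.sin u ^ 2 * iteratedDeriv 2 f (Real.cos u) -
        Real.cos u * iteratedDeriv 1 f (Real.cos u) :=
    funext fun u => by
      rw [((hd 1 (by norm_num) u).fun_mul (Real.hasDerivAt_sin u).fun_neg).deriv]
      ring
  have h3 : deriv (fun u => Real.sin u ^ 2 * iteratedDeriv 2 f (Real.cos u) -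
        Real.cos u * iteratedDeriv 1 f (Real.cos u)) =
      fun u => 3 * (Real.sin u * Real.cos u) * iteratedDeriv 2 f (Real.cos u) -
        Real.sin u ^ 3 * iteratedDeriv 3 f (Real.cos u) +
        Real.sin u * iteratedDeriv 1 f (Real.cos u) :=
    funext fun u => by
      rw [((((Real.hasDerivAt_sin u).fun_pow 2).fun_mul (hd 2 (by norm_num) u)).fun_sub
        ((Real.hasDerivAt_cos u).fun_mul (hd 1 (by norm_num) u))).deriv]
      push_cast
      ring
  rw [iteratedDeriv_succ', iteratedDeriv_succ', iteratedDeriv_succ', iteratedDeriv_one, h1, h2, h3]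
  rw [((((((Real.hasDerivAt_sin 0).fun_mul (Real.hasDerivAt_cos 0)).const_mul 3).fun_mul
    (hd 2 (by norm_num) 0)).fun_sub (((Real.hasDerivAt_sin 0).fun_pow 3).fun_mul
    (hd 3 (by norm_num) 0))).fun_add
    ((Real.hasDerivAt_sin 0).fun_mul (hd 1 (by norm_num) 0))).deriv]
  simp

theorem legendreKernel_same_longitude (l : ℕ) (θ₁ θ₂ φ : ℝ) :
    legendreKernel l θ₁ φ θ₂ φ = legendre l (Real.cos (θ₁ - θ₂)) := by
  simp [legendreKernel, Real.cos_sub]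

theorem stmt4 (l : ℕ) (θ φ : ℝ) (hθ : θ ∈ Set.Ioo 0 Real.pi) :
    iteratedDeriv 2 (fun θ₂ => iteratedDeriv 2 (fun θ₁ => legendreKernel l θ₁ φ θ₂ φ) θ) θ =
      3 * iteratedDeriv 2 (legendre l) 1 + deriv (legendre l) 1 := by
  rw [← iteratedDeriv_four_comp_cos_zero (contDiff_legendre l 4)]
  simp_rw [legendreKernel_same_longitude]
  have h (θ₂ : ℝ) : iteratedDeriv 2 (fun θ₁ => legendre l (Real.cos (θ₁ - θ₂))) θ =
      iteratedDeriv 2 (fun u => legendre l (Real.cos u)) (θ - θ₂) :=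
    congrFun (iteratedDeriv_comp_sub_const 2 (fun u => legendre l (Real.cos u)) θ₂) θ
  simp_rw [h]
  rw [iteratedDeriv_comp_const_sub]
  simp [iteratedDeriv_eq_iterate]
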